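/- arXiv:1303.0969 — 2 statements merged into one kernel-verified Lean document; each statement's English description precedes it below -/
import Mathlib

section
/- Let α ∈ (0,1) be irrational, ρ ∈ [0,1), and let w be a factor of the Sturmian word u_{α,ρ} of length n ≥ 1. Put I = [0, frac(nα)) if w is light and I = [frac(nα), 1) if w is heavy. Then a binary word v is an abelian return word to w in u_{α,ρ} if and only if v is an I-itinerary, i.e., v = R_I(x) for some x ∈ I. -/
open Set

noncomputable section

/-- Exchange of two intervals with parameter `α`, acting on `[0,1)`:
`T_α(x) = x + 1 - α` for `x ∈ [0,α)` and `T_α(x) = x - α` for `x ∈ [α,1)`. -/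
def twoIE (α x : ℝ) : ℝ := if x < α then x + 1 - α else x - α

/-- The Sturmian word with slope `α` and intercept `ρ`:
`false` codes the letter 0 (i.e. `T_α^n(ρ) ∈ [0,α)`), `true` codes the letter 1. -/
def sturmian (α ρ : ℝ) (n : ℕ) : Bool := if α ≤ (twoIE α)^[n] ρ then true else false

/-- The factor of length `n` of an infinite word `u` starting at position `i`. -/
def seg (u : ℕ → Bool) (i n : ℕ) : List Bool := (List.range n).map (fun j => u (i + j))

/-- The prefix of length `n` of `u`. -/
def wordPrefix (u : ℕ → Bool) (n : ℕ) : List Bool := seg u 0 n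

/-- Return time of `x` to the set `I` under `twoIE α`:
the least `m ≥ 1` such that `T_α^m(x) ∈ I`. -/
def returnTime (α : ℝ) (I : Set ℝ) (x : ℝ) : ℕ :=
  sInf {m : ℕ | 0 < m ∧ (twoIE α)^[m] x ∈ I}

/-- The `I`-itinerary of `x`: the prefix of length `returnTime α I x` of the
Sturmian word with slope `α` and intercept `x`. -/
def itin (α : ℝ) (I : Set ℝ) (x : ℝ) : List Bool :=
  wordPrefix (sturmian α x) (returnTime α I x)

/-- Two binary words are abelian equivalent if they have the same length and the
same number of occurrences of the letter 0 (coded by `false`). -/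
def AbEquiv (w w' : List Bool) : Prop :=
  w.length = w'.length ∧ w.count false = w'.count false

/-- `w` is a factor of the infinite word `u`. -/
def IsFactor (u : ℕ → Bool) (w : List Bool) : Prop := ∃ i, seg u i w.length = w

/-- Positions of occurrences in `u` of factors abelian equivalent to `w`. -/
def abOcc (u : ℕ → Bool) (w : List Bool) : Set ℕ :=
  {i | AbEquiv (seg u i w.length) w}

/-- The set of abelian return words to `w` in `u`: the words of `u` lying between
two consecutive occurrences of factors abelian equivalent to `w`. -/
def AR (u : ℕ → Bool) (w : List Bool) : Set (List Bool) :=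
  {v | ∃ i j : ℕ, i ∈ abOcc u w ∧ j ∈ abOcc u w ∧ i < j ∧
        (∀ m, i < m → m < j → m ∉ abOcc u w) ∧ v = seg u i (j - i)}

/-- The set of abelian return words to all nonempty prefixes of `u`. -/
def APR (u : ℕ → Bool) : Set (List Bool) :=
  ⋃ n ∈ {n : ℕ | 1 ≤ n}, AR u (wordPrefix u n)

/-- `S_β`: the set of `[0,β)`-itineraries under `twoIE α`. -/
def Sitin (α β : ℝ) : Set (List Bool) :=
  {w | ∃ x ∈ Ico (0:ℝ) β, itin α (Ico (0:ℝ) β) x = w}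

/-- `R^α_ρ`: the union of the sets of `[0,β)`-itineraries over `ρ ≤ β < 1`. -/
def Rlight (α ρ : ℝ) : Set (List Bool) := ⋃ β ∈ Ico ρ 1, Sitin α β

/-- `R'^α_ρ`: the union of the sets of `[γ,1)`-itineraries over `0 < γ ≤ ρ`. -/
def Rheavy (α ρ : ℝ) : Set (List Bool) :=
  ⋃ γ ∈ Ioc (0:ℝ) ρ, {w | ∃ x ∈ Ico γ 1, itin α (Ico γ 1) x = w}

/-- The Gauss map `x ↦ {1/x}`. -/
def gaussMap (x : ℝ) : ℝ := Int.fract x⁻¹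

/-- The `k`-th partial quotient `a_k` (for `k ≥ 1`) of the continued fraction
expansion `α = [0; a_1, a_2, …]` of `α ∈ (0,1)`. -/
def cfa (α : ℝ) (k : ℕ) : ℕ := ⌊(gaussMap^[k - 1] α)⁻¹⌋₊

/-- `cfPQ α n = (p_{n-1}, q_{n-1})`, numerators and denominators of the convergents
of `α`: `p_{-1} = 1`, `q_{-1} = 0`, `p_0 = 0`, `q_0 = 1`,
`p_k = a_k p_{k-1} + p_{k-2}`, `q_k = a_k q_{k-1} + q_{k-2}`. -/
def cfPQ (α : ℝ) : ℕ → ℤ × ℤ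
  | 0 => (1, 0)
  | 1 => (0, 1)
  | (k + 2) => ((cfa α (k + 1) : ℤ) * (cfPQ α (k + 1)).1 + (cfPQ α k).1,
                (cfa α (k + 1) : ℤ) * (cfPQ α (k + 1)).2 + (cfPQ α k).2)

/-- `δ_{k,s} = |(s-1)(p_k - α q_k) + p_{k-1} - α q_{k-1}|` for `k ≥ 0`, `1 ≤ s ≤ a_{k+1}`. -/
def cfDelta (α : ℝ) (k s : ℕ) : ℝ :=
  |((s : ℝ) - 1) * (((cfPQ α (k + 1)).1 : ℝ) - α * ((cfPQ α (k + 1)).2 : ℝ)) +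
      (((cfPQ α k).1 : ℝ) - α * ((cfPQ α k).2 : ℝ))|

end

open Filter Topology

theorem twoIE_mem_Ico {α x : ℝ} (hα : α ∈ Ioo (0:ℝ) 1) (hx : x ∈ Ico (0:ℝ) 1) :
    twoIE α x ∈ Ico (0:ℝ) 1 := by
  obtain ⟨h0, h1⟩ := hα
  obtain ⟨hx0, hx1⟩ := hx
  unfold twoIE
  split_ifs with h
  · constructor <;> linarith
  · constructor <;> linarith

theorem twoIE_iterate_mem_Ico {α x : ℝ} (hα : α ∈ Ioo (0:ℝ) 1) (hx : x ∈ Ico (0:ℝ) 1) (m : ℕ) :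
    (twoIE α)^[m] x ∈ Ico (0:ℝ) 1 := by
  induction m with
  | zero => exact hx
  | succ k ih =>
    rw [Function.iterate_succ_apply']
    exact twoIE_mem_Ico hα ih

theorem seg_length (u : ℕ → Bool) (i k : ℕ) : (seg u i k).length = k := by
  simp [seg]

theorem seg_sturmian_shift (α ρ : ℝ) (i k : ℕ) :
    seg (sturmian α ρ) i k = wordPrefix (sturmian α ((twoIE α)^[i] ρ)) k := by
  simp only [seg, wordPrefix, sturmian, zero_add]
  refine List.map_congr_left fun j _ => ?_
  rw [add_comm i j, Function.iterate_add_apply]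

/-- Each letter `0` read along the orbit contributes a full turn to the rotation by `-α`. -/
theorem twoIE_iterate_eq (α x : ℝ) (k : ℕ) :
    (twoIE α)^[k] x = x - k * α + ((wordPrefix (sturmian α x) k).count false : ℝ) := by
  induction k with
  | zero => simp [wordPrefix, seg]
  | succ k ih =>
    have hstep : wordPrefix (sturmian α x) (k + 1) =
        wordPrefix (sturmian α x) k ++ [sturmian α x k] := by
      simp [wordPrefix, seg, List.range_succ]
    rw [Function.iterate_succ_apply', hstep, List.count_append]
    by_cases h : (twoIE α)^[k] x < α
    · have hs : sturmian α x k = false := by simp [sturmian, h]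
      rw [hs, twoIE, if_pos h, ih]
      push_cast
      simp
      ring
    · have hs : sturmian α x k = true := by simp [sturmian, not_lt.mp h]
      rw [hs, twoIE, if_neg h, ih]
      push_cast
      simp
      ring

/-- The number of `0`s in the prefix of length `n` is determined by the position of the intercept
relative to `fract (n * α)`. -/
theorem count_false_wordPrefix {α x : ℝ} (hα : α ∈ Ioo (0:ℝ) 1) (hx : x ∈ Ico (0:ℝ) 1) (n : ℕ) :
    (wordPrefix (sturmian α x) n).count false =
      if x < Int.fract ((n : ℝ) * α) then ⌊(n : ℝ) * α⌋₊ + 1 else ⌊(n : ℝ) * α⌋₊ := by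
  have heq := twoIE_iterate_eq α x n
  obtain ⟨hT0, hT1⟩ := twoIE_iterate_mem_Ico hα hx n
  obtain ⟨hx0, hx1⟩ := hx
  set c := (wordPrefix (sturmian α x) n).count false
  have hnn : (0:ℝ) ≤ n * α := mul_nonneg (Nat.cast_nonneg n) hα.1.le
  have hfl : (⌊(n : ℝ) * α⌋₊ : ℝ) + Int.fract ((n : ℝ) * α) = n * α := by
    rw [natCast_floor_eq_intCast_floor hnn]
    exact Int.floor_add_fract _
  set f := ⌊(n : ℝ) * α⌋₊
  have hf0 := Int.fract_nonneg ((n : ℝ) * α)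
  have hf1 := Int.fract_lt_one ((n : ℝ) * α)
  split_ifs with h
  · have h1 : (f : ℝ) < c := by linarith
    have h2 : (c : ℝ) < ((f + 2 : ℕ) : ℝ) := by push_cast; linarith
    have h1' : f < c := by exact_mod_cast h1
    have h2' : c < f + 2 := by exact_mod_cast h2
    omega
  · have h1 : (f : ℝ) < ((c + 1 : ℕ) : ℝ) := by push_cast; linarith
    have h2 : (c : ℝ) < ((f + 1 : ℕ) : ℝ) := by push_cast; linarith
    have h1' : f < c + 1 := by exact_mod_cast h1
    have h2' : c < f + 1 := by exact_mod_cast h2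
    omega

theorem exists_twoIE_iterate_mem_Ioo {α ρ a b : ℝ} (hα : α ∈ Ioo (0:ℝ) 1) (hirr : Irrational α)
    (hρ : ρ ∈ Ico (0:ℝ) 1) (ha : 0 ≤ a) (hab : a < b) (hb : b ≤ 1) :
    ∃ i : ℕ, (twoIE α)^[i] ρ ∈ Ioo a b := by
  have : Fact ((0:ℝ) < 1) := ⟨one_pos⟩
  have hd : DenseRange fun m : ℕ => m • ((-α : ℝ) : AddCircle (1:ℝ)) := by
    rw [← denseRange_zsmul_iff_nsmul, AddCircle.denseRange_zsmul_coe_iff]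
    simpa using hirr.neg
  have hopen : IsOpen ((fun z : AddCircle (1:ℝ) => z + (ρ : AddCircle (1:ℝ))) ⁻¹'
      ((fun y : ℝ => (y : AddCircle (1:ℝ))) '' Ioo a b)) :=
    (QuotientAddGroup.isOpenMap_coe _ isOpen_Ioo).preimage (continuous_add_const _)
  obtain ⟨m, y, hy, hym⟩ := hd.exists_mem_open hopen
    ⟨(((a + b) / 2 - ρ : ℝ) : AddCircle (1:ℝ)), (a + b) / 2, by constructor <;> linarith, by
      simp⟩
  have hT := twoIE_iterate_mem_Ico hα hρ m
  refine ⟨m, ?_⟩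
  have hcoe : (((twoIE α)^[m] ρ : ℝ) : AddCircle (1:ℝ)) = (y : AddCircle (1:ℝ)) := by
    have hsum : (twoIE α)^[m] ρ =
        (m • (-α) + ρ) + ((wordPrefix (sturmian α ρ) m).count false : ℝ) := by
      rw [twoIE_iterate_eq, nsmul_eq_mul]
      ring
    have hzero : (((wordPrefix (sturmian α ρ) m).count false : ℝ) : AddCircle (1:ℝ)) = 0 :=
      (AddCircle.coe_eq_zero_iff _).mpr ⟨(wordPrefix (sturmian α ρ) m).count false, by simp⟩
    rw [hsum, AddCircle.coe_add, hzero, add_zero]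
    exact hym.symm
  have : (twoIE α)^[m] ρ = y := by
    refine (AddCircle.coe_eq_coe_iff_of_mem_Ico (p := (1:ℝ)) (a := 0) ?_ ?_).mp hcoe
    · simpa using hT
    · rw [zero_add]; exact ⟨by linarith [hy.1], by linarith [hy.2]⟩
  rwa [this]

theorem eventually_nhdsGE_le_iff (a z : ℝ) : ∀ᶠ y in 𝓝[≥] z, (a ≤ y ↔ a ≤ z) := by
  rcases le_or_gt a z with h | h
  · filter_upwards [self_mem_nhdsWithin] with y hy
    exact ⟨fun _ => h, fun _ => h.trans hy⟩
  · filter_upwards [nhdsWithin_le_nhds (Iio_mem_nhds h)] with y hy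
    exact ⟨fun h' => absurd h' (not_le.mpr hy), fun h' => absurd h' (not_le.mpr h)⟩

theorem eventually_nhdsGE_mem_Ico_iff (a b z : ℝ) :
    ∀ᶠ y in 𝓝[≥] z, (y ∈ Ico a b ↔ z ∈ Ico a b) := by
  filter_upwards [eventually_nhdsGE_le_iff a z, eventually_nhdsGE_le_iff b z] with y h1 h2
  rw [mem_Ico, mem_Ico, h1, ← not_le, h2, not_le]

theorem tendsto_twoIE_nhdsGE (α z : ℝ) : Tendsto (twoIE α) (𝓝[≥] z) (𝓝[≥] (twoIE α z)) := by
  have hev : (fun y => y + (twoIE α z - z)) =ᶠ[𝓝[≥] z] twoIE α := by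
    filter_upwards [eventually_nhdsGE_le_iff α z] with y hy
    unfold twoIE
    by_cases h : z < α
    · rw [if_pos h, if_pos (not_le.mp (mt hy.mp (not_le.mpr h)))]; ring
    · rw [if_neg h, if_neg (not_lt.mpr (hy.mpr (not_lt.mp h)))]; ring
  refine Tendsto.congr' hev ?_
  refine tendsto_nhdsWithin_iff.mpr ⟨?_, ?_⟩
  · have hc : Continuous fun y : ℝ => y + (twoIE α z - z) := by fun_prop
    have := (hc.tendsto z).mono_left (nhdsWithin_le_nhds (s := Ici z))
    simpa using this
  · filter_upwards [self_mem_nhdsWithin] with y hy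
    simp only [mem_Ici] at hy ⊢
    linarith

theorem tendsto_twoIE_iterate_nhdsGE (α z : ℝ) (m : ℕ) :
    Tendsto ((twoIE α)^[m]) (𝓝[≥] z) (𝓝[≥] ((twoIE α)^[m] z)) := by
  induction m with
  | zero => exact tendsto_id
  | succ k ih =>
    rw [Function.iterate_succ', Function.comp_apply]
    exact (tendsto_twoIE_nhdsGE α _).comp ih

/-- Points of `Ico 0 1` return to any nondegenerate interval `Ico a b`. -/
theorem returnTime_spec {α x a b : ℝ} (hα : α ∈ Ioo (0:ℝ) 1) (hirr : Irrational α)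
    (hx : x ∈ Ico (0:ℝ) 1) (ha : 0 ≤ a) (hab : a < b) (hb : b ≤ 1) :
    0 < returnTime α (Ico a b) x ∧ (twoIE α)^[returnTime α (Ico a b) x] x ∈ Ico a b := by
  have hne : {m : ℕ | 0 < m ∧ (twoIE α)^[m] x ∈ Ico a b}.Nonempty := by
    obtain ⟨i, hi⟩ := exists_twoIE_iterate_mem_Ioo hα hirr (twoIE_mem_Ico hα hx) ha hab hb
    exact ⟨i + 1, i.succ_pos, by
      rw [Function.iterate_succ_apply]; exact Ioo_subset_Ico_self hi⟩
  exact Nat.sInf_mem hne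

theorem returnTime_eq {α x : ℝ} {I : Set ℝ} {r : ℕ} (hr : 0 < r) (hmem : (twoIE α)^[r] x ∈ I)
    (hmin : ∀ m, 0 < m → m < r → (twoIE α)^[m] x ∉ I) : returnTime α I x = r := by
  refine le_antisymm (Nat.sInf_le ⟨hr, hmem⟩) (le_csInf ⟨r, hr, hmem⟩ ?_)
  rintro m ⟨hm, hmI⟩
  by_contra h
  exact hmin m hm (not_le.mp h) hmI

theorem mem_AR_iff_itin {α ρ a b : ℝ} {w : List Bool} (hα : α ∈ Ioo (0:ℝ) 1)
    (hirr : Irrational α) (hρ : ρ ∈ Ico (0:ℝ) 1) (ha : 0 ≤ a) (hab : a < b) (hb : b ≤ 1)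
    (hocc : ∀ i, i ∈ abOcc (sturmian α ρ) w ↔ (twoIE α)^[i] ρ ∈ Ico a b) (v : List Bool) :
    v ∈ AR (sturmian α ρ) w ↔ ∃ x ∈ Ico a b, itin α (Ico a b) x = v := by
  constructor
  · rintro ⟨i, j, hi, hj, hij, hmin, rfl⟩
    refine ⟨(twoIE α)^[i] ρ, (hocc i).mp hi, ?_⟩
    rw [itin, seg_sturmian_shift, returnTime_eq (r := j - i) (by omega)]
    · rw [← Function.iterate_add_apply, Nat.sub_add_cancel hij.le]
      exact (hocc j).mp hj
    · intro m h0 hm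
      rw [← Function.iterate_add_apply, ← hocc]
      exact hmin _ (by omega) (by omega)
  · rintro ⟨x, hx, rfl⟩
    have hx01 : x ∈ Ico (0:ℝ) 1 := ⟨ha.trans hx.1, hx.2.trans_le hb⟩
    obtain ⟨hr0, hrI⟩ := returnTime_spec hα hirr hx01 ha hab hb
    rw [itin]
    have hmin : ∀ m, 0 < m → m < returnTime α (Ico a b) x → (twoIE α)^[m] x ∉ Ico a b :=
      fun m h0 hm hI => Nat.notMem_of_lt_sInf hm ⟨h0, hI⟩
    generalize returnTime α (Ico a b) x = r at hr0 hrI hmin ⊢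
    have hev : ∀ᶠ y in 𝓝[≥] x, ∀ m ∈ Finset.range (r + 1),
        (α ≤ (twoIE α)^[m] y ↔ α ≤ (twoIE α)^[m] x) ∧
          ((twoIE α)^[m] y ∈ Ico a b ↔ (twoIE α)^[m] x ∈ Ico a b) := by
      rw [Finset.eventually_all]
      intro m _
      exact (tendsto_twoIE_iterate_nhdsGE α x m).eventually
        ((eventually_nhdsGE_le_iff α _).and (eventually_nhdsGE_mem_Ico_iff a b _))
    obtain ⟨c, hxc, hc⟩ := mem_nhdsGE_iff_exists_Ico_subset.mp hev
    obtain ⟨i, hi1, hi2⟩ := exists_twoIE_iterate_mem_Ioo hα hirr hρ hx01.1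
      (lt_min hxc hx01.2) (min_le_right c 1)
    have hnear := hc ⟨hi1.le, hi2.trans_le (min_le_left c 1)⟩
    have hI : ∀ m ≤ r, (i + m ∈ abOcc (sturmian α ρ) w ↔ (twoIE α)^[m] x ∈ Ico a b) := by
      intro m hm
      rw [hocc, add_comm, Function.iterate_add_apply]
      exact (hnear m (Finset.mem_range.mpr (by omega))).2
    refine ⟨i, i + r, (hI 0 (by omega)).mpr hx, (hI r le_rfl).mpr hrI, by omega, ?_, ?_⟩
    · intro m h1 h2
      obtain ⟨k, rfl⟩ := Nat.exists_eq_add_of_lt h1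
      rw [add_assoc, hI _ (by omega)]
      exact hmin _ (by omega) (by omega)
    · rw [Nat.add_sub_cancel_left, seg_sturmian_shift]
      simp only [wordPrefix, seg, sturmian, zero_add]
      refine List.map_congr_left fun m hm => ?_
      rw [List.mem_range] at hm
      simp only [(hnear m (Finset.mem_range.mpr (by omega))).1]

/-- for a factor `w` of length `n` of `u_{α,ρ}`, with `I = [0, frac(nα))`
if `w` is light and `I = [frac(nα), 1)` if `w` is heavy, a word `v` is an abelian
return word to `w` in `u_{α,ρ}` iff `v` is an `I`-itinerary. -/
theorem abelian_return_iff_itinerary (α ρ : ℝ) (hα : α ∈ Set.Ioo (0:ℝ) 1)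
    (hirr : Irrational α) (hρ : ρ ∈ Set.Ico (0:ℝ) 1) (n : ℕ) (hn : 1 ≤ n)
    (w : List Bool) (hw : IsFactor (sturmian α ρ) w) (hlen : w.length = n)
    (I : Set ℝ)
    (hI : (w.count false = ⌊(n : ℝ) * α⌋₊ + 1 ∧
            I = Set.Ico (0:ℝ) (Int.fract ((n : ℝ) * α))) ∨
          (w.count false = ⌊(n : ℝ) * α⌋₊ ∧
            I = Set.Ico (Int.fract ((n : ℝ) * α)) 1)) :
    ∀ v : List Bool, v ∈ AR (sturmian α ρ) w ↔ ∃ x ∈ I, itin α I x = v := by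
  have hocc : ∀ i, i ∈ abOcc (sturmian α ρ) w ↔
      (if (twoIE α)^[i] ρ < Int.fract ((n : ℝ) * α) then ⌊(n : ℝ) * α⌋₊ + 1
        else ⌊(n : ℝ) * α⌋₊) = w.count false := by
    intro i
    rw [← count_false_wordPrefix hα (twoIE_iterate_mem_Ico hα hρ i) n, ← seg_sturmian_shift]
    simp [abOcc, AbEquiv, seg_length, hlen]
  have hpos : 0 < Int.fract ((n : ℝ) * α) := by
    refine Int.fract_pos.mpr fun h => ?_
    exact (hirr.natCast_mul (by omega : n ≠ 0)).ne_int _ h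
  have hlt := Int.fract_lt_one ((n : ℝ) * α)
  rcases hI with ⟨hc, rfl⟩ | ⟨hc, rfl⟩
  · refine mem_AR_iff_itin hα hirr hρ le_rfl hpos hlt.le fun i => ?_
    have hi := twoIE_iterate_mem_Ico hα hρ i
    rw [hocc, hc]
    split_ifs with h
    · simp [hi.1, h]
    · simp [not_lt.mp h]
  · refine mem_AR_iff_itin hα hirr hρ hpos.le hlt le_rfl fun i => ?_
    have hi := twoIE_iterate_mem_Ico hα hρ i
    rw [hocc, hc]
    split_ifs with h
    · simp [h]
    · simp [not_lt.mp h, hi.2]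
end

section
/- Let α, ρ ∈ (0,1) with α irrational and let u = u_{α,ρ} be the corresponding Sturmian word. For every factor w of u there exist finite binary words w₁ and w₂ such that every abelian return word to w in u belongs to {w₁, w₂, w₁w₂}, i.e., AR_{w,u} ⊆ {w₁, w₂, w₁w₂}. -/
open Set

/-- The word of length `n` whose `j`-th letter records whether `f (j + 1) = f j`. -/
def stepWord (f : ℕ → ℤ) (n : ℕ) : List Bool :=
  (List.range n).map (fun j => decide (f (j + 1) = f j))

lemma stepWord_congr {f g : ℕ → ℤ} {n : ℕ} (h : ∀ j ≤ n, f j = g j) :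
    stepWord f n = stepWord g n := by
  unfold stepWord
  refine List.map_congr_left fun j hj => ?_
  rw [List.mem_range] at hj
  rw [h j hj.le, h (j + 1) hj]

lemma stepWord_append {f g h : ℕ → ℤ} {m n : ℕ} (hf : ∀ j ≤ m, h j = f j)
    (hg : ∀ j ≤ n, h (m + j) - h m = g j - g 0) :
    stepWord h (m + n) = stepWord f m ++ stepWord g n := by
  rw [← stepWord_congr hf]
  unfold stepWord
  rw [List.range_add, List.map_append, List.map_map]
  congr 1
  refine List.map_congr_left fun j hj => ?_
  rw [List.mem_range] at hj
  have h₁ := hg j hj.le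
  have h₂ := hg (j + 1) hj
  rw [← add_assoc] at h₂
  simp only [Function.comp]
  congr 1
  rw [eq_iff_iff]
  constructor <;> intro h <;> omega

lemma count_stepWord {f : ℕ → ℤ} (hf : ∀ j, f (j + 1) = f j ∨ f (j + 1) = f j - 1) (n : ℕ) :
    ((stepWord f n).count false : ℤ) = f 0 - f n := by
  induction n with
  | zero => simp [stepWord]
  | succ n ih =>
    have hs : stepWord f (n + 1) = stepWord f n ++ [decide (f (n + 1) = f n)] := by
      simp [stepWord, List.range_succ]
    rw [hs, List.count_append]
    push_cast
    rw [ih]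
    rcases hf n with h | h
    · simp [h]
    · have : f (n + 1) ≠ f n := by omega
      simp [this]
      omega

/-- The rotation by `-α` of the origin: `rotPos α j = {-jα}`. -/
noncomputable def rotPos (α : ℝ) (j : ℕ) : ℝ := Int.fract (-(j * α))

lemma rotPos_nonneg (α : ℝ) (j : ℕ) : 0 ≤ rotPos α j := Int.fract_nonneg _

lemma rotPos_lt_one (α : ℝ) (j : ℕ) : rotPos α j < 1 := Int.fract_lt_one _

lemma floor_add_rotPos (α : ℝ) (j : ℕ) : (⌊-(j * α)⌋ : ℝ) + rotPos α j = -(j * α) :=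
  Int.floor_add_fract _

lemma rotPos_add (α : ℝ) (i j : ℕ) :
    (rotPos α (i + j) = rotPos α i + rotPos α j ∧
      ⌊-(((i + j : ℕ) : ℝ) * α)⌋ = ⌊-(i * α)⌋ + ⌊-(j * α)⌋) ∨
    (rotPos α (i + j) = rotPos α i + rotPos α j - 1 ∧
      ⌊-(((i + j : ℕ) : ℝ) * α)⌋ = ⌊-(i * α)⌋ + ⌊-(j * α)⌋ + 1) := by
  have h := floor_add_rotPos α (i + j)
  have hi := floor_add_rotPos α i
  have hj := floor_add_rotPos α j
  have h0 := rotPos_nonneg α i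
  have h1 := rotPos_nonneg α j
  have h2 := rotPos_lt_one α i
  have h3 := rotPos_lt_one α j
  have h4 : -(((i + j : ℕ) : ℝ) * α) = -(i * α) + -(j * α) := by push_cast; ring
  rcases lt_or_ge (rotPos α i + rotPos α j) 1 with hlt | hge
  · left
    have hz : ⌊-(((i + j : ℕ) : ℝ) * α)⌋ = ⌊-(i * α)⌋ + ⌊-(j * α)⌋ := by
      rw [Int.floor_eq_iff]
      push_cast at *
      constructor <;> linarith
    refine ⟨?_, hz⟩
    rw [hz] at h
    push_cast at *
    linarith
  · right
    have hz : ⌊-(((i + j : ℕ) : ℝ) * α)⌋ = ⌊-(i * α)⌋ + ⌊-(j * α)⌋ + 1 := by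
      rw [Int.floor_eq_iff]
      push_cast at *
      constructor <;> linarith
    refine ⟨?_, hz⟩
    rw [hz] at h
    push_cast at *
    linarith

lemma floor_sub_of_lt {α x : ℝ} {j : ℕ} (hx : 0 ≤ x) (h : x + rotPos α j < 1) :
    ⌊x - j * α⌋ = ⌊-(j * α)⌋ := by
  have := floor_add_rotPos α j
  have := rotPos_nonneg α j
  rw [Int.floor_eq_iff]
  constructor <;> linarith

lemma floor_sub_of_ge {α x : ℝ} {j : ℕ} (hx : x < 1) (h : 1 ≤ x + rotPos α j) :
    ⌊x - j * α⌋ = ⌊-(j * α)⌋ + 1 := by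
  have := floor_add_rotPos α j
  have := rotPos_lt_one α j
  rw [Int.floor_eq_iff]
  push_cast
  constructor <;> linarith

lemma fract_sub_of_lt {α x : ℝ} {j : ℕ} (hx : 0 ≤ x) (h : x + rotPos α j < 1) :
    Int.fract (x - j * α) = x + rotPos α j := by
  have := floor_add_rotPos α j
  rw [Int.fract, floor_sub_of_lt hx h]
  linarith

lemma fract_sub_of_ge {α x : ℝ} {j : ℕ} (hx : x < 1) (h : 1 ≤ x + rotPos α j) :
    Int.fract (x - j * α) = x + rotPos α j - 1 := by
  have := floor_add_rotPos α j
  rw [Int.fract, floor_sub_of_ge hx h]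
  push_cast
  linarith

lemma exists_fract_mul_lt (ξ : ℝ) {ε : ℝ} (hε : 0 < ε) :
    ∃ m : ℕ, 0 < m ∧ Int.fract (m * ξ) < ε := by
  obtain ⟨n, hn⟩ := exists_nat_one_div_lt (lt_min hε one_pos)
  obtain ⟨k, hk, -, hle⟩ := Real.exists_nat_abs_mul_sub_round_le ξ n.succ_pos
  have hn1 : (1 : ℝ) / (n + 1) < ε := hn.trans_le (min_le_left _ _)
  have hn2 : (1 : ℝ) / (n + 1) < 1 := hn.trans_le (min_le_right _ _)
  have hle' : |(k : ℝ) * ξ - round ((k : ℝ) * ξ)| < 1 / (n + 1) := by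
    refine hle.trans_lt ?_
    push_cast
    exact one_div_lt_one_div_of_lt (by positivity) (by linarith)
  obtain ⟨hl, hu⟩ := abs_lt.1 hle'
  set z := round ((k : ℝ) * ξ)
  rcases le_or_gt (z : ℝ) (k * ξ) with h | h
  · refine ⟨k, hk, ?_⟩
    have : ⌊(k : ℝ) * ξ⌋ = z := by
      rw [Int.floor_eq_iff]
      constructor <;> linarith
    rw [Int.fract, this]
    linarith
  · set δ : ℝ := z - k * ξ with hδ
    have hδ0 : 0 < δ := by linarith
    have hδ1 : 1 ≤ 1 / δ := by rw [le_div_iff₀ hδ0]; linarith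
    have hN : 0 < ⌊1 / δ⌋₊ := Nat.floor_pos.2 hδ1
    have h1 : (⌊1 / δ⌋₊ : ℝ) * δ ≤ 1 := by
      rw [← le_div_iff₀ hδ0]; exact Nat.floor_le (by positivity)
    have h2 : 1 < (⌊1 / δ⌋₊ + 1 : ℝ) * δ := by
      rw [← div_lt_iff₀ hδ0]; exact Nat.lt_floor_add_one _
    refine ⟨⌊1 / δ⌋₊ * k, Nat.mul_pos hN hk, ?_⟩
    generalize ⌊1 / δ⌋₊ = N at *
    have hNδ : 0 < (N : ℝ) * δ := by positivity
    have he : ((N * k : ℕ) : ℝ) * ξ = N * z - N * δ := by rw [hδ]; push_cast; ring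
    have hf : ⌊((N * k : ℕ) : ℝ) * ξ⌋ = N * z - 1 := by
      rw [Int.floor_eq_iff, he]
      push_cast
      constructor <;> linarith
    rw [Int.fract, hf, he]
    push_cast
    linarith

/-- `r` is the least positive integer satisfying `p`. -/
def IsLeastPos (p : ℕ → Prop) (r : ℕ) : Prop :=
  0 < r ∧ p r ∧ ∀ k, 0 < k → k < r → ¬ p k

lemma exists_isLeastPos {p : ℕ → Prop} (h : ∃ m, 0 < m ∧ p m) : ∃ r, IsLeastPos p r := by
  classical
  exact ⟨Nat.find h, (Nat.find_spec h).1, (Nat.find_spec h).2,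
    fun k hk hlt hp => Nat.find_min h hlt ⟨hk, hp⟩⟩

lemma exists_isLeastPos_rotPos_lt (α : ℝ) {L : ℝ} (hL : 0 < L) :
    ∃ r, IsLeastPos (fun k => rotPos α k < L) r := by
  obtain ⟨m, hm, h⟩ := exists_fract_mul_lt (-α) hL
  refine exists_isLeastPos ⟨m, hm, ?_⟩
  rwa [rotPos, ← mul_neg]

lemma rotPos_pos {α : ℝ} (hirr : Irrational α) {j : ℕ} (hj : 0 < j) : 0 < rotPos α j := by
  refine Int.fract_pos.2 fun h => ?_
  have := (hirr.natCast_mul hj.ne').neg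
  exact this.ne_int _ h

lemma exists_isLeastPos_one_sub_rotPos_lt {α : ℝ} (hirr : Irrational α) {L : ℝ} (hL : 0 < L) :
    ∃ r, IsLeastPos (fun k => 1 - rotPos α k < L) r := by
  obtain ⟨m, hm, h⟩ := exists_fract_mul_lt α hL
  refine exists_isLeastPos ⟨m, hm, ?_⟩
  have hne : Int.fract (m * α) ≠ 0 := by
    have := rotPos_pos hirr hm
    rw [rotPos] at this
    intro h0
    rw [Int.fract_neg_eq_zero.2 h0] at this
    exact this.false
  rw [rotPos, Int.fract_neg hne]
  linarith

/-- For `x ∈ [a, a + L) ⊆ [0, 1)`, the rotation by `-kα` sends `x` into `[a, a + L)`. -/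
def Returns (α a L x : ℝ) (k : ℕ) : Prop :=
  x + rotPos α k < a + L ∨ a + 1 ≤ x + rotPos α k

lemma fract_sub_mem_iff_returns {α a L x : ℝ} (ha : 0 ≤ a) (haL : a + L ≤ 1)
    (hx : x ∈ Ico a (a + L)) (k : ℕ) :
    Int.fract (x - k * α) ∈ Ico a (a + L) ↔ Returns α a L x k := by
  obtain ⟨h1, h2⟩ := hx
  have := rotPos_nonneg α k
  have := rotPos_lt_one α k
  unfold Returns
  rcases lt_or_ge (x + rotPos α k) 1 with h | h
  · rw [fract_sub_of_lt (ha.trans h1) h]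
    constructor
    · exact fun h => Or.inl h.2
    · rintro (h | h)
      · exact ⟨by linarith, h⟩
      · linarith
  · rw [fract_sub_of_ge (by linarith) h]
    constructor
    · exact fun h => Or.inr (by linarith [h.1])
    · rintro (h | h)
      · linarith
      · exact ⟨by linarith, by linarith⟩

/-- Three gap theorem: the first return time to an interval is the least forward return `r`,
the least backward return `s`, or `r + s`. -/
lemma first_return_trichotomy {α a L x : ℝ} {r s m : ℕ}
    (hx : x ∈ Ico a (a + L)) (hL : L ≤ 1)
    (hr : IsLeastPos (fun k => rotPos α k < L) r)
    (hs : IsLeastPos (fun k => 1 - rotPos α k < L) s)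
    (hm : IsLeastPos (Returns α a L x) m) :
    (m = r ∧ x + rotPos α r < a + L) ∨ (m = s ∧ a + 1 ≤ x + rotPos α s) ∨
      (m = r + s ∧ a + L ≤ x + rotPos α r ∧ x + rotPos α s < a + 1) := by
  obtain ⟨hr0, hrL, hrm⟩ := hr
  obtain ⟨hs0, hsL, hsm⟩ := hs
  obtain ⟨hm0, hmR, hmm⟩ := hm
  obtain ⟨hx1, hx2⟩ := hx
  have ht0 := rotPos_nonneg α
  have ht1 := rotPos_lt_one α
  simp only at hrL hsL hrm hsm
  rcases lt_or_ge (x + rotPos α r) (a + L) with h1 | h1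
  · refine Or.inl ⟨?_, h1⟩
    rcases lt_trichotomy m r with h | h | h
    · exfalso
      rcases hmR with h2 | h2
      · exact hrm m hm0 h (by linarith)
      · obtain ⟨d, rfl⟩ := Nat.exists_eq_add_of_lt h
        have hd := rotPos_add α m (d + 1)
        have := hrm (d + 1) (by omega) (by omega)
        rw [← add_assoc] at hd
        have := ht0 (d + 1)
        have := ht1 m
        have := ht0 m
        rcases hd with ⟨hd, -⟩ | ⟨hd, -⟩ <;> linarith
    · exact h
    · exact (hmm r hr0 h (Or.inl h1)).elim
  rcases lt_or_ge (x + rotPos α s) (a + 1) with h2 | h2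
  · refine Or.inr (Or.inr ⟨?_, h1, h2⟩)
    rcases lt_trichotomy m (r + s) with h | h | h
    · exfalso
      rcases hmR with h3 | h3
      · have hrle : r ≤ m := by
          by_contra! hlt
          exact hrm m hm0 hlt (by linarith)
        have hne : r ≠ m := by rintro rfl; linarith
        obtain ⟨d, rfl⟩ := Nat.exists_eq_add_of_lt (lt_of_le_of_ne hrle hne)
        have hd := rotPos_add α r (d + 1)
        have := hsm (d + 1) (by omega) (by omega)
        rw [← add_assoc] at hd
        have := ht0 (d + 1)
        have := ht0 (r + d + 1)
        rcases hd with ⟨hd, -⟩ | ⟨hd, -⟩ <;> linarith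
      · have hsle : s ≤ m := by
          by_contra! hlt
          exact hsm m hm0 hlt (by linarith)
        have hne : s ≠ m := by rintro rfl; linarith
        obtain ⟨d, rfl⟩ := Nat.exists_eq_add_of_lt (lt_of_le_of_ne hsle hne)
        have hd := rotPos_add α s (d + 1)
        have := hrm (d + 1) (by omega) (by omega)
        rw [← add_assoc] at hd
        have := ht1 (d + 1)
        have := ht1 (s + d + 1)
        rcases hd with ⟨hd, -⟩ | ⟨hd, -⟩ <;> linarith
    · exact h
    · refine (hmm (r + s) (by omega) h ?_).elim
      rcases rotPos_add α r s with ⟨hd, -⟩ | ⟨hd, -⟩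
      · exact Or.inr (by linarith)
      · exact Or.inl (by linarith)
  · refine Or.inr (Or.inl ⟨?_, h2⟩)
    rcases lt_trichotomy m s with h | h | h
    · exfalso
      rcases hmR with h3 | h3
      · obtain ⟨d, rfl⟩ := Nat.exists_eq_add_of_lt h
        have hd := rotPos_add α m (d + 1)
        have := hsm (d + 1) (by omega) (by omega)
        rw [← add_assoc] at hd
        have := ht0 m
        have := ht1 (d + 1)
        rcases hd with ⟨hd, -⟩ | ⟨hd, -⟩ <;> linarith
      · exact hsm m hm0 h (by linarith)
    · exact h
    · exact (hmm s hs0 h (Or.inr h2)).elim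

/-- The integer part after `r + s` steps of rotation when the total shift of `x`
is the sum of a forward shift by `r` steps and a backward shift by `s` steps. -/
lemma floor_sub_add {α x : ℝ} {r s : ℕ} (h0 : 0 ≤ x + rotPos α r + rotPos α s - 1)
    (h1 : x + rotPos α r + rotPos α s - 1 < 1) :
    ⌊x - ((r + s : ℕ) : ℝ) * α⌋ = ⌊-(r * α)⌋ + ⌊-(s * α)⌋ + 1 := by
  have := floor_add_rotPos α r
  have := floor_add_rotPos α s
  rw [Int.floor_eq_iff]
  push_cast
  constructor <;> linarith

lemma exists_itineraries_left (α : ℝ) (hirr : Irrational α) {L : ℝ} (hL : 0 < L)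
    (hL1 : L ≤ 1) :
    ∃ w₁ w₂ : List Bool, ∀ x ∈ Ico (0 : ℝ) L, ∀ m, IsLeastPos (Returns α 0 L x) m →
      stepWord (fun j => ⌊x - j * α⌋) m ∈ ({w₁, w₂, w₁ ++ w₂} : Set (List Bool)) := by
  obtain ⟨r, hr⟩ := exists_isLeastPos_rotPos_lt α hL
  obtain ⟨s, hs⟩ := exists_isLeastPos_one_sub_rotPos_lt hirr hL
  have ht0 := rotPos_nonneg α
  have ht1 := rotPos_lt_one α
  let f : ℕ → ℤ := fun j => ⌊-(j * α)⌋
  let g : ℕ → ℤ := fun j => if j < s then ⌊-(j * α)⌋ else ⌊-(j * α)⌋ + 1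
  refine ⟨stepWord f r, stepWord g s, fun x hx m hm => ?_⟩
  have hlow : ∀ j < m, ⌊x - j * α⌋ = ⌊-(j * α)⌋ := by
    intro j hj
    rcases Nat.eq_zero_or_pos j with rfl | hj0
    · simpa using ⟨hx.1, hx.2.trans_le hL1⟩
    · refine floor_sub_of_lt hx.1 ?_
      have := hm.2.2 j hj0 hj
      unfold Returns at this
      push Not at this
      linarith [this.2]
  have htri := first_return_trichotomy (a := 0) (by simpa using hx) hL1 hr hs hm
  simp only [zero_add] at htri
  rcases htri with ⟨rfl, h⟩ | ⟨rfl, h⟩ | ⟨rfl, h, h'⟩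
  · left
    refine stepWord_congr fun j hj => ?_
    rcases hj.lt_or_eq with hj | rfl
    · exact hlow j hj
    · exact floor_sub_of_lt hx.1 (by linarith)
  · right; left
    refine stepWord_congr fun j hj => ?_
    rcases hj.lt_or_eq with hj | rfl
    · simp [g, hj, hlow j hj]
    · simpa [g] using floor_sub_of_ge (hx.2.trans_le hL1) h
  · right; right
    have hrL : rotPos α r < L := hr.2.1
    have hsL : 1 - rotPos α s < L := hs.2.1
    have hr0 := hr.1
    have hs0 := hs.1
    refine stepWord_append (fun j hj => hlow j (by omega)) fun j hj => ?_
    have hg0 : g 0 = 0 := by simp [g, hs0]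
    rw [hg0, sub_zero, hlow r (by omega)]
    rcases hj.lt_or_eq with hj | rfl
    · rw [hlow (r + j) (by omega)]
      simp only [g, hj, if_true]
      rcases rotPos_add α r j with ⟨-, hd⟩ | ⟨hd, -⟩
      · omega
      · exfalso
        have h2 := ht0 (r + j)
        rcases Nat.eq_zero_or_pos j with rfl | hj0
        · simp only [add_zero] at hd
          linarith [ht1 0]
        · exact hs.2.2 j hj0 hj (by linarith)
    · rw [floor_sub_add (by linarith) (by linarith)]
      simp [g]
      ring

lemma exists_itineraries_right (α : ℝ) (hirr : Irrational α) {L : ℝ} (hL : 0 < L)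
    (hL1 : L ≤ 1) :
    ∃ w₁ w₂ : List Bool, ∀ x ∈ Ico (1 - L) 1, ∀ m, IsLeastPos (Returns α (1 - L) L x) m →
      stepWord (fun j => ⌊x - j * α⌋) m ∈ ({w₁, w₂, w₁ ++ w₂} : Set (List Bool)) := by
  obtain ⟨r, hr⟩ := exists_isLeastPos_rotPos_lt α hL
  obtain ⟨s, hs⟩ := exists_isLeastPos_one_sub_rotPos_lt hirr hL
  have ht0 := rotPos_nonneg α
  have ht1 := rotPos_lt_one α
  let f : ℕ → ℤ := fun j => if j = 0 then 0 else if j < r then ⌊-(j * α)⌋ + 1 else ⌊-(j * α)⌋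
  let g : ℕ → ℤ := fun j => if j = 0 then 0 else ⌊-(j * α)⌋ + 1
  refine ⟨stepWord g s, stepWord f r, fun x hx m hm => ?_⟩
  have hx0 : 0 ≤ x := by linarith [hx.1]
  have hzero : ⌊x - ((0 : ℕ) : ℝ) * α⌋ = 0 := by simpa using ⟨hx0, hx.2⟩
  have hlow : ∀ j, 0 < j → j < m → ⌊x - j * α⌋ = ⌊-(j * α)⌋ + 1 := by
    intro j hj0 hj
    refine floor_sub_of_ge hx.2 ?_
    have := hm.2.2 j hj0 hj
    unfold Returns at this
    push Not at this
    linarith [this.1]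
  have htri := first_return_trichotomy (a := 1 - L) (by simpa using hx) hL1 hr hs hm
  simp only [sub_add_cancel] at htri
  rcases htri with ⟨rfl, h⟩ | ⟨rfl, h⟩ | ⟨rfl, h, h'⟩
  · right; left
    refine stepWord_congr fun j hj => ?_
    rcases Nat.eq_zero_or_pos j with rfl | hj0
    · simpa [f] using hzero
    rcases hj.lt_or_eq with hj | rfl
    · simp [f, hj, hj0.ne', hlow j hj0 hj]
    · simpa [f, hj0.ne'] using floor_sub_of_lt hx0 h
  · left
    refine stepWord_congr fun j hj => ?_
    rcases Nat.eq_zero_or_pos j with rfl | hj0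
    · simpa [g] using hzero
    rcases hj.lt_or_eq with hj | rfl
    · simp [g, hj0.ne', hlow j hj0 hj]
    · simpa [g, hj0.ne'] using floor_sub_of_ge hx.2 (by linarith)
  · right; right
    have hrL : rotPos α r < L := hr.2.1
    have hsL : 1 - rotPos α s < L := hs.2.1
    have hr0 := hr.1
    have hs0 := hs.1
    rw [add_comm r s]
    refine stepWord_append (fun j hj => ?_) fun j hj => ?_
    · rcases Nat.eq_zero_or_pos j with rfl | hj0
      · simpa [g] using hzero
      · simp [g, hj0.ne', hlow j hj0 (by omega)]
    have hf0 : f 0 = 0 := by simp [f]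
    rw [hf0, sub_zero]
    rcases Nat.eq_zero_or_pos j with rfl | hj0
    · simp [f]
    rw [hlow s hs0 (by omega)]
    rcases hj.lt_or_eq with hj | rfl
    · rw [hlow (s + j) (by omega) (by omega)]
      simp only [f, hj, hj0.ne', if_true, if_false]
      rcases rotPos_add α s j with ⟨hd, -⟩ | ⟨-, hd⟩
      · exfalso
        have h2 := ht1 (s + j)
        exact hr.2.2 j hj0 hj (by linarith)
      · omega
    · rw [floor_sub_add (by linarith) (by linarith)]
      simp [f, hj0.ne']

lemma iterate_twoIE {α x : ℝ} (hα : α ∈ Ioo (0 : ℝ) 1) (hx : x ∈ Ico (0 : ℝ) 1) (n : ℕ) :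
    (twoIE α)^[n] x = Int.fract (x - n * α) := by
  induction n with
  | zero => simpa using (Int.fract_eq_self.2 hx).symm
  | succ n ih =>
    rw [Function.iterate_succ_apply', ih]
    have h0 := Int.fract_nonneg (x - n * α)
    have h1 := Int.fract_lt_one (x - n * α)
    have h2 := Int.floor_add_fract (x - n * α)
    obtain ⟨hα0, hα1⟩ := hα
    symm
    rw [Int.fract_eq_iff]
    unfold twoIE
    split_ifs with h
    · exact ⟨by linarith, by linarith, ⌊x - n * α⌋ - 1, by push_cast; linarith⟩
    · exact ⟨by linarith, by linarith, ⌊x - n * α⌋, by push_cast; linarith⟩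

lemma fract_sub_add_mul (α ρ : ℝ) (i j : ℕ) :
    Int.fract (ρ - ((i + j : ℕ) : ℝ) * α) = Int.fract (Int.fract (ρ - i * α) - j * α) := by
  rw [Int.fract_eq_fract]
  refine ⟨⌊ρ - i * α⌋, ?_⟩
  have := Int.floor_add_fract (ρ - i * α)
  push_cast
  linarith

lemma floor_sub_succ {α : ℝ} (hα : α ∈ Ioo (0 : ℝ) 1) (x : ℝ) (j : ℕ) :
    (α ≤ Int.fract (x - j * α) ∧ ⌊x - ((j + 1 : ℕ) : ℝ) * α⌋ = ⌊x - j * α⌋) ∨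
      (Int.fract (x - j * α) < α ∧ ⌊x - ((j + 1 : ℕ) : ℝ) * α⌋ = ⌊x - j * α⌋ - 1) := by
  have h0 := Int.fract_nonneg (x - j * α)
  have h1 := Int.fract_lt_one (x - j * α)
  have h2 := Int.floor_add_fract (x - j * α)
  obtain ⟨hα0, hα1⟩ := hα
  rcases le_or_gt α (Int.fract (x - j * α)) with h | h
  · refine Or.inl ⟨h, ?_⟩
    rw [Int.floor_eq_iff]
    push_cast
    constructor <;> linarith
  · refine Or.inr ⟨h, ?_⟩
    rw [Int.floor_eq_iff]
    push_cast
    constructor <;> linarith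

lemma seg_sturmian {α ρ : ℝ} (hα : α ∈ Ioo (0 : ℝ) 1) (hρ : ρ ∈ Ico (0 : ℝ) 1) (i n : ℕ) :
    seg (sturmian α ρ) i n = stepWord (fun j => ⌊Int.fract (ρ - i * α) - j * α⌋) n := by
  unfold seg stepWord
  refine List.map_congr_left fun j _ => ?_
  simp only [sturmian]
  rw [iterate_twoIE hα hρ, fract_sub_add_mul]
  rcases floor_sub_succ hα (Int.fract (ρ - i * α)) j with ⟨h, h'⟩ | ⟨h, h'⟩
  · simp only [h, h', if_true, decide_true]
  · simp only [h.not_ge, h', if_false]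
    exact (decide_eq_false (by omega)).symm

lemma mem_abOcc_sturmian_iff {α ρ : ℝ} (hα : α ∈ Ioo (0 : ℝ) 1) (hρ : ρ ∈ Ico (0 : ℝ) 1)
    {w : List Bool} {k : ℕ} (hk : seg (sturmian α ρ) k w.length = w) (i : ℕ) :
    i ∈ abOcc (sturmian α ρ) w ↔
      ⌊Int.fract (ρ - i * α) - w.length * α⌋ = ⌊Int.fract (ρ - k * α) - w.length * α⌋ := by
  have hc : ∀ i : ℕ, ((seg (sturmian α ρ) i w.length).count false : ℤ) =
      - ⌊Int.fract (ρ - i * α) - w.length * α⌋ := by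
    intro i
    rw [seg_sturmian hα hρ, count_stepWord]
    · simp
    · intro j
      rcases floor_sub_succ hα (Int.fract (ρ - i * α)) j with ⟨-, h⟩ | ⟨-, h⟩
      · exact Or.inl h
      · exact Or.inr h
  have hl : (seg (sturmian α ρ) i w.length).length = w.length := by simp [seg]
  have hi := hc i
  have hck := hc k
  rw [hk] at hck
  simp only [abOcc, AbEquiv, mem_ofPred_eq, hl, true_and]
  omega

/-- If the abelian occurrences are the visits of the orbit to `[a, a + L)`, then abelian return
words are itineraries of first returns to this interval. -/
lemma exists_first_return_of_mem_AR {α ρ a L : ℝ} (hα : α ∈ Ioo (0 : ℝ) 1)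
    (hρ : ρ ∈ Ico (0 : ℝ) 1) (ha : 0 ≤ a) (haL : a + L ≤ 1) {w v : List Bool}
    (hw : ∀ i, i ∈ abOcc (sturmian α ρ) w ↔ Int.fract (ρ - i * α) ∈ Ico a (a + L))
    (hv : v ∈ AR (sturmian α ρ) w) :
    ∃ x ∈ Ico a (a + L), ∃ m, IsLeastPos (Returns α a L x) m ∧
      v = stepWord (fun j => ⌊x - j * α⌋) m := by
  obtain ⟨i, j, hi, hj, hij, hmin, rfl⟩ := hv
  rw [hw] at hi
  refine ⟨_, hi, j - i, ⟨by omega, ?_, fun k hk hkj => ?_⟩, seg_sturmian hα hρ _ _⟩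
  · rw [← fract_sub_mem_iff_returns ha haL hi, ← fract_sub_add_mul, ← hw]
    rwa [show i + (j - i) = j by omega]
  · rw [← fract_sub_mem_iff_returns ha haL hi, ← fract_sub_add_mul, ← hw]
    exact hmin _ (by omega) (by omega)

/-- for every factor `w` of a Sturmian word `u` there exist words
`w₁, w₂` with `AR_{w,u} ⊆ {w₁, w₂, w₁w₂}`. -/
theorem abelian_returns_subset_triple (α ρ : ℝ) (hα : α ∈ Set.Ioo (0:ℝ) 1)
    (hirr : Irrational α) (hρ : ρ ∈ Set.Ioo (0:ℝ) 1)
    (w : List Bool) (hw : IsFactor (sturmian α ρ) w) :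
    ∃ w₁ w₂ : List Bool,
      AR (sturmian α ρ) w ⊆ ({w₁, w₂, w₁ ++ w₂} : Set (List Bool)) := by
  obtain ⟨k, hk⟩ := hw
  have hρ' : ρ ∈ Set.Ico (0:ℝ) 1 := ⟨hρ.1.le, hρ.2⟩
  have hocc := mem_abOcc_sturmian_iff hα hρ' hk
  have hx0 : ∀ i : ℕ, 0 ≤ Int.fract (ρ - i * α) := fun i => Int.fract_nonneg _
  have hx1 : ∀ i : ℕ, Int.fract (ρ - i * α) < 1 := fun i => Int.fract_lt_one _
  have ht0 := rotPos_nonneg α w.length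
  have ht1 := rotPos_lt_one α w.length
  rcases lt_or_ge (Int.fract (ρ - k * α) + rotPos α w.length) 1 with h | h
  · obtain ⟨w₁, w₂, H⟩ := exists_itineraries_left α hirr (L := 1 - rotPos α w.length)
      (by linarith) (by linarith)
    have hJ : ∀ i, i ∈ abOcc (sturmian α ρ) w ↔
        Int.fract (ρ - i * α) ∈ Set.Ico 0 (0 + (1 - rotPos α w.length)) := by
      intro i
      rw [hocc, floor_sub_of_lt (hx0 k) h]
      rcases lt_or_ge (Int.fract (ρ - i * α) + rotPos α w.length) 1 with hi | hi
      · rw [floor_sub_of_lt (hx0 i) hi]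
        exact iff_of_true rfl ⟨hx0 i, by linarith⟩
      · rw [floor_sub_of_ge (hx1 i) hi]
        exact iff_of_false (by omega) fun hm => by linarith [hm.2]
    refine ⟨w₁, w₂, fun v hv => ?_⟩
    obtain ⟨x, hx, m, hm, rfl⟩ :=
      exists_first_return_of_mem_AR hα hρ' le_rfl (by linarith) hJ hv
    exact H x (by simpa using hx) m hm
  · obtain ⟨w₁, w₂, H⟩ := exists_itineraries_right α hirr (L := rotPos α w.length)
      (by linarith [hx1 k]) (by linarith)
    have hJ : ∀ i, i ∈ abOcc (sturmian α ρ) w ↔ Int.fract (ρ - i * α) ∈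
        Set.Ico (1 - rotPos α w.length) (1 - rotPos α w.length + rotPos α w.length) := by
      intro i
      rw [hocc, floor_sub_of_ge (hx1 k) h]
      rcases lt_or_ge (Int.fract (ρ - i * α) + rotPos α w.length) 1 with hi | hi
      · rw [floor_sub_of_lt (hx0 i) hi]
        exact iff_of_false (by omega) fun hm => by linarith [hm.1]
      · rw [floor_sub_of_ge (hx1 i) hi]
        exact iff_of_true rfl ⟨by linarith, by linarith [hx1 i]⟩
    refine ⟨w₁, w₂, fun v hv => ?_⟩
    obtain ⟨x, hx, m, hm, rfl⟩ :=
      exists_first_return_of_mem_AR hα hρ' (by linarith) (by linarith) hJ hv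
    exact H x (by simpa using hx) m hm
end
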